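/- An extremal effect vector e is a wiring if and only if it has a wiring representation, i.e., if and only if there exists a single deterministic wiring vector w such that ⟨w, P⟩ = ⟨e, P⟩ for every P ∈ S_NS. -/

import Mathlib

open Finset

/-- The standard inner product on `ℝ^(X × A)`. -/
def ip {N nI nO : ℕ} (e P : (Fin N → Fin nI) → (Fin N → Fin nO) → ℝ) : ℝ :=
  ∑ x : Fin N → Fin nI, ∑ a : Fin N → Fin nO, e x a * P x a

/-- The single-party no-signalling conditions. -/
def NoSig (N nI nO : ℕ) (P : (Fin N → Fin nI) → (Fin N → Fin nO) → ℝ) : Prop :=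
  ∀ i : Fin N, ∀ x x' : Fin N → Fin nI, (∀ j, j ≠ i → x j = x' j) →
    ∀ a : Fin N → Fin nO,
      ∑ b : Fin nO, P x (Function.update a i b) =
      ∑ b : Fin nO, P x' (Function.update a i b)

/-- The state space of no-signalling behaviours. -/
def SNS (N nI nO : ℕ) (P : (Fin N → Fin nI) → (Fin N → Fin nO) → ℝ) : Prop :=
  NoSig N nI nO P ∧ (∀ x a, 0 ≤ P x a) ∧
    (∀ x : Fin N → Fin nI, ∑ a : Fin N → Fin nO, P x a = 1)

/-- Effect vectors: `0 ≤ ⟨e, P⟩ ≤ 1` on all no-signalling states. -/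
def IsEffect (N nI nO : ℕ) (e : (Fin N → Fin nI) → (Fin N → Fin nO) → ℝ) : Prop :=
  ∀ P, SNS N nI nO P → 0 ≤ ip e P ∧ ip e P ≤ 1

/-- Extremal effect vectors. -/
def IsExtremalEffect (N nI nO : ℕ) (e : (Fin N → Fin nI) → (Fin N → Fin nO) → ℝ) : Prop :=
  IsEffect N nI nO e ∧
  ∀ e₁ e₂ : (Fin N → Fin nI) → (Fin N → Fin nO) → ℝ, ∀ α : ℝ,
    IsEffect N nI nO e₁ → IsEffect N nI nO e₂ → 0 < α → α < 1 →
    (∀ P, SNS N nI nO P → ip e P = α * ip e₁ P + (1 - α) * ip e₂ P) →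
    (∀ P, SNS N nI nO P → ip e₁ P = ip e P ∧ ip e₂ P = ip e P)

/-- Deterministic wiring vectors, defined recursively on the number of parties. -/
inductive IsDetWiring (nI nO : ℕ) : (N : ℕ) → ((Fin N → Fin nI) → (Fin N → Fin nO) → ℝ) → Prop
  | base (xhat : Fin nI) (T : Finset (Fin nO)) :
      IsDetWiring nI nO 1 (fun x a => if x 0 = xhat ∧ a 0 ∈ T then 1 else 0)
  | step (m : ℕ) (hm : 1 ≤ m) (k : Fin (m + 1)) (xhat : Fin nI)
      (w : Fin nO → (Fin m → Fin nI) → (Fin m → Fin nO) → ℝ)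
      (hw : ∀ b, IsDetWiring nI nO m (w b)) :
      IsDetWiring nI nO (m + 1)
        (fun x a => if x k = xhat then
          w (a k) (fun j => x (k.succAbove j)) (fun j => a (k.succAbove j)) else 0)

/-- An effect vector is a wiring if its functional on the state space is a convex
combination of functionals of deterministic wiring vectors. -/
def IsWiring (N nI nO : ℕ) (e : (Fin N → Fin nI) → (Fin N → Fin nO) → ℝ) : Prop :=
  ∃ (n : ℕ) (w : Fin n → (Fin N → Fin nI) → (Fin N → Fin nO) → ℝ) (lam : Fin n → ℝ),
    (∀ i, IsDetWiring nI nO N (w i)) ∧ (∀ i, 0 ≤ lam i) ∧ (∑ i, lam i) = 1 ∧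
    ∀ P, SNS N nI nO P → ip e P = ∑ i, lam i * ip (w i) P

theorem sum_insertNth_eq {m n : ℕ} {M : Type*} [AddCommMonoid M] (k : Fin (m + 1))
    (f : (Fin (m + 1) → Fin n) → M) :
    ∑ a, f a = ∑ b : Fin n, ∑ a : Fin m → Fin n, f (k.insertNth b a) := by
  rw [← Fintype.sum_prod_type' (f := fun (b : Fin n) (a : Fin m → Fin n) => f (k.insertNth b a))]
  exact (Equiv.sum_comp (Fin.insertNthEquiv (fun _ => Fin n) k) f).symm

theorem sum_update_eq_sum {m n : ℕ} (k : Fin (m + 1)) (b₀ : Fin n)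
    (f : (Fin (m + 1) → Fin n) → ℝ) :
    ∑ a, f a = ∑ a : Fin m → Fin n, ∑ b, f (Function.update (k.insertNth b₀ a) k b) := by
  rw [sum_insertNth_eq k, Finset.sum_comm]
  simp only [Fin.update_insertNth]

theorem NoSig.sum_eq_of_agree {N nI nO : ℕ} {P : (Fin N → Fin nI) → (Fin N → Fin nO) → ℝ}
    (hP : NoSig N nI nO P) (hO : 0 < nO) (i : Fin N) {x x' : Fin N → Fin nI}
    (h : ∀ j, j ≠ i → x j = x' j) : ∑ a, P x a = ∑ a, P x' a := by
  cases N with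
  | zero => exact i.elim0
  | succ m =>
    rw [sum_update_eq_sum i ⟨0, hO⟩, sum_update_eq_sum i ⟨0, hO⟩ (P x')]
    exact Finset.sum_congr rfl fun a _ => hP i x x' h _

/-- The total mass of a no-signalling vector does not depend on the input tuple. -/
theorem NoSig.sum_eq {N nI nO : ℕ} {P : (Fin N → Fin nI) → (Fin N → Fin nO) → ℝ}
    (hP : NoSig N nI nO P) (hO : 0 < nO) (x x' : Fin N → Fin nI) :
    ∑ a, P x a = ∑ a, P x' a := by
  have key : ∀ s : Finset (Fin N), ∑ a, P (s.piecewise x x') a = ∑ a, P x' a := by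
    intro s
    induction s using Finset.induction_on with
    | empty => simp
    | insert i s _ ih =>
      rw [← ih, Finset.piecewise_insert]
      exact hP.sum_eq_of_agree hO i fun j hj => Function.update_of_ne hj _ _
  simpa using key Finset.univ

/-- Fixing the input and the output of one party preserves the no-signalling conditions. -/
theorem NoSig.insertNth {m nI nO : ℕ}
    {P : (Fin (m + 1) → Fin nI) → (Fin (m + 1) → Fin nO) → ℝ} (hP : NoSig (m + 1) nI nO P)
    (k : Fin (m + 1)) (y : Fin nI) (b : Fin nO) :
    NoSig m nI nO (fun x a => P (k.insertNth y x) (k.insertNth b a)) := by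
  intro i x x' h a
  have h' : ∀ j, j ≠ k.succAbove i →
      k.insertNth (α := fun _ => Fin nI) y x j = k.insertNth (α := fun _ => Fin nI) y x' j := by
    intro j hj
    induction j using k.succAboveCases with
    | x => simp
    | p j =>
      simp only [Fin.insertNth_apply_succAbove]
      exact h j fun hji => hj (congrArg _ hji)
  simpa only [Fin.insertNth_update] using hP (k.succAbove i) _ _ h' (k.insertNth b a)

theorem ip_step {m nI nO : ℕ} (k : Fin (m + 1)) (y : Fin nI)
    (w : Fin nO → (Fin m → Fin nI) → (Fin m → Fin nO) → ℝ)
    (P : (Fin (m + 1) → Fin nI) → (Fin (m + 1) → Fin nO) → ℝ) :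
    ip (fun x a => if x k = y then
        w (a k) (fun j => x (k.succAbove j)) (fun j => a (k.succAbove j)) else 0) P =
      ∑ b, ip (w b) (fun x a => P (k.insertNth y x) (k.insertNth b a)) := by
  unfold ip
  rw [sum_insertNth_eq k, Finset.sum_eq_single y]
  · refine Eq.trans (Finset.sum_congr rfl fun x _ => ?_) Finset.sum_comm
    rw [sum_insertNth_eq k]
    simp
  · intro z _ hz
    simp [hz]
  · simp

/-- On nonnegative no-signalling vectors, a deterministic wiring is bounded by the total mass. -/
theorem IsDetWiring.ip_mem {N nI nO : ℕ} {w : (Fin N → Fin nI) → (Fin N → Fin nO) → ℝ}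
    (hw : IsDetWiring nI nO N w) (hO : 0 < nO)
    {P : (Fin N → Fin nI) → (Fin N → Fin nO) → ℝ} (hP : NoSig N nI nO P)
    (h0 : ∀ x a, 0 ≤ P x a) (x : Fin N → Fin nI) :
    0 ≤ ip w P ∧ ip w P ≤ ∑ a, P x a := by
  induction hw with
  | base y T =>
    have hip : ip (fun x a => if x 0 = y ∧ a 0 ∈ T then (1 : ℝ) else 0) P =
        ∑ a, if a 0 ∈ T then P (fun _ => y) a else 0 := by
      unfold ip
      rw [Finset.sum_eq_single fun _ => y]
      · simp
      · intro z _ hz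
        have : z 0 ≠ y := fun h => hz (funext fun j => by rw [Subsingleton.elim j 0, h])
        simp [this]
      · simp
    rw [hip, hP.sum_eq hO x fun _ => y]
    refine ⟨Finset.sum_nonneg fun a _ => ?_, Finset.sum_le_sum fun a _ => ?_⟩ <;>
      split_ifs <;> simp [h0]
  | step m _ k y w _ ih =>
    rw [ip_step, hP.sum_eq hO x (k.insertNth y fun j => x (k.succAbove j)), sum_insertNth_eq k]
    have hb := fun b => ih b (hP.insertNth k y b) (fun _ _ => h0 _ _) fun j => x (k.succAbove j)
    exact ⟨Finset.sum_nonneg fun b _ => (hb b).1, Finset.sum_le_sum fun b _ => (hb b).2⟩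

theorem IsDetWiring.isEffect {N nI nO : ℕ} {w : (Fin N → Fin nI) → (Fin N → Fin nO) → ℝ}
    (hw : IsDetWiring nI nO N w) (hI : 0 < nI) (hO : 0 < nO) : IsEffect N nI nO w := by
  intro P hP
  have h := hw.ip_mem hO hP.1 hP.2.1 fun _ => ⟨0, hI⟩
  rwa [hP.2.2] at h

theorem ip_smul_sub {N nI nO : ℕ} (e w P : (Fin N → Fin nI) → (Fin N → Fin nO) → ℝ) (c d : ℝ) :
    ip (fun x a => c * (e x a - d * w x a)) P = c * (ip e P - d * ip w P) := by
  simp only [ip, Finset.mul_sum, ← Finset.sum_sub_distrib]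
  exact Finset.sum_congr rfl fun x _ => Finset.sum_congr rfl fun a _ => by ring

/-- If an extremal effect is a convex combination of effects on the state space, it coincides
there with each of them that has positive weight. -/
theorem IsExtremalEffect.ip_eq {N nI nO n : ℕ}
    {e : (Fin N → Fin nI) → (Fin N → Fin nO) → ℝ} (he : IsExtremalEffect N nI nO e)
    {w : Fin n → (Fin N → Fin nI) → (Fin N → Fin nO) → ℝ} {lam : Fin n → ℝ}
    (hw : ∀ i, IsEffect N nI nO (w i)) (h0 : ∀ i, 0 ≤ lam i) (h1 : ∑ i, lam i = 1)
    (h : ∀ P, SNS N nI nO P → ip e P = ∑ i, lam i * ip (w i) P) {i : Fin n} (hi : 0 < lam i)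
    {P : (Fin N → Fin nI) → (Fin N → Fin nO) → ℝ} (hP : SNS N nI nO P) :
    ip (w i) P = ip e P := by
  have hle : lam i ≤ 1 := h1 ▸ Finset.single_le_sum (fun j _ => h0 j) (Finset.mem_univ i)
  have hpos : 0 < 1 - lam i / 2 := by linarith
  refine (he.2 (w i) (fun x a => (1 - lam i / 2)⁻¹ * (e x a - lam i / 2 * w i x a)) (lam i / 2)
    (hw i) ?_ (by linarith) (by linarith) ?_ P hP).1
  · intro Q hQ
    have hiQ := hw i Q hQ
    have hlow : lam i * ip (w i) Q ≤ ip e Q := by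
      rw [h Q hQ]
      exact Finset.single_le_sum (f := fun j => lam j * ip (w j) Q)
        (fun j _ => mul_nonneg (h0 j) (hw j Q hQ).1) (Finset.mem_univ i)
    have hupp : lam i * (1 - ip (w i) Q) ≤ 1 - ip e Q := by
      calc lam i * (1 - ip (w i) Q) ≤ ∑ j, lam j * (1 - ip (w j) Q) :=
            Finset.single_le_sum (f := fun j => lam j * (1 - ip (w j) Q))
              (fun j _ => mul_nonneg (h0 j) (sub_nonneg.2 (hw j Q hQ).2)) (Finset.mem_univ i)
        _ = 1 - ip e Q := by
            simp only [mul_sub, mul_one, Finset.sum_sub_distrib, h1, h Q hQ]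
    rw [ip_smul_sub]
    refine ⟨mul_nonneg (inv_nonneg.2 hpos.le) ?_, (inv_mul_le_one₀ hpos).2 ?_⟩
    · nlinarith [mul_nonneg hi.le hiQ.1]
    · nlinarith [mul_nonneg hi.le (sub_nonneg.2 hiQ.2)]
  · intro Q _
    rw [ip_smul_sub, mul_inv_cancel_left₀ hpos.ne']
    ring

theorem extremal_effect_wiring_iff_wiring_representation (N nI nO : ℕ)
    (hN : 0 < N) (hI : 0 < nI) (hO : 0 < nO)
    (e : (Fin N → Fin nI) → (Fin N → Fin nO) → ℝ)
    (he : IsExtremalEffect N nI nO e) :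
    IsWiring N nI nO e ↔
      ∃ w : (Fin N → Fin nI) → (Fin N → Fin nO) → ℝ,
        IsDetWiring nI nO N w ∧ ∀ P, SNS N nI nO P → ip w P = ip e P := by
  constructor
  · rintro ⟨n, w, lam, hw, h0, h1, h⟩
    obtain ⟨i, -, hi⟩ : ∃ i ∈ Finset.univ, 0 < lam i :=
      Finset.exists_lt_of_sum_lt (by simp [h1])
    exact ⟨w i, hw i, fun P hP => he.ip_eq (fun j => (hw j).isEffect hI hO) h0 h1 h hi hP⟩
  · rintro ⟨w, hw, h⟩
    exact ⟨1, fun _ => w, fun _ => 1, fun _ => hw, by simp, by simp,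
      fun P hP => by simp [h P hP]⟩
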